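/- For every t×q real matrix G, the function λ ↦ D(λ·G) is monotone nondecreasing on [0, ∞): if 0 ≤ λ₁ ≤ λ₂ then D(λ₁·G) ≤ D(λ₂·G). -/

import Mathlib

open Matrix

/-- The information gain of the secondary channel matrix `G`. -/
noncomputable def infoGain {p q t : ℕ}
    (Qθx : Matrix (Fin p) (Fin p) ℝ) (M : Matrix (Fin q) (Fin p) ℝ)
    (Qφθ : Matrix (Fin q) (Fin q) ℝ) (Qv : Matrix (Fin t) (Fin t) ℝ)
    (G : Matrix (Fin t) (Fin q) ℝ) : ℝ :=
  (1 / 2 : ℝ) *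
    Real.log ((1 + Mᵀ * Gᵀ * (G * Qφθ * Gᵀ + Qv)⁻¹ * G * M * Qθx).det)

open scoped MatrixOrder in
theorem Matrix.PosSemidef.exists_eq_mul_transpose {n : Type*} [Fintype n] [DecidableEq n]
    {S : Matrix n n ℝ} (hS : S.PosSemidef) : ∃ R : Matrix n n ℝ, S = R * Rᵀ := by
  obtain ⟨R, hR⟩ := CStarAlgebra.nonneg_iff_eq_mul_star_self.mp hS.nonneg
  exact ⟨R, by rw [hR, star_eq_conjTranspose, conjTranspose_eq_transpose_of_trivial]⟩

theorem Matrix.PosSemidef.one_le_det_one_add {n : Type*} [Fintype n] [DecidableEq n]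
    {X : Matrix n n ℝ} (hX : X.PosSemidef) : 1 ≤ (1 + X).det := by
  have h : (1 + X).det = ∏ i, (1 + hX.isHermitian.eigenvalues i) := by
    have h₁ := eval_charpoly X (-1)
    have h₂ : scalar n (-1 : ℝ) - X = -(1 + X) := by
      rw [map_neg, map_one]; abel
    rw [h₂, det_neg, hX.isHermitian.charpoly_eq, Polynomial.eval_prod] at h₁
    have h₃ : ∀ i, (Polynomial.X - Polynomial.C (hX.isHermitian.eigenvalues i)).eval (-1 : ℝ)
        = -(1 + hX.isHermitian.eigenvalues i) := by
      intro i; simp; ring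
    simp only [RCLike.ofReal_real_eq_id, id_eq, h₃, Finset.prod_neg, Finset.card_univ] at h₁
    exact (mul_left_cancel₀ (pow_ne_zero _ (by norm_num)) h₁).symm
  rw [h]
  exact Finset.one_le_prod fun i _ => le_add_of_nonneg_right (hX.eigenvalues_nonneg i)

theorem Matrix.PosDef.det_le_det_add {n : Type*} [Fintype n] [DecidableEq n]
    {P E : Matrix n n ℝ} (hP : P.PosDef) (hE : E.PosSemidef) : P.det ≤ (P + E).det := by
  obtain ⟨R, rfl⟩ := hE.exists_eq_mul_transpose
  rw [det_add_mul _ _ hP.det_pos.ne'.isUnit]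
  refine le_mul_of_one_le_right hP.det_pos.le (PosSemidef.one_le_det_one_add ?_)
  simpa using hP.inv.posSemidef.conjTranspose_mul_mul_same R

/-- Both conditions say that the block matrix `[A C; Cᵀ D]` is positive semidefinite. -/
theorem Matrix.PosDef.posSemidef_schur_comm {m n : Type*} [Fintype m] [Fintype n] [DecidableEq m]
    [DecidableEq n] {A : Matrix m m ℝ} {D : Matrix n n ℝ} (hA : A.PosDef) (hD : D.PosDef)
    (C : Matrix m n ℝ) :
    (A - C * D⁻¹ * Cᵀ).PosSemidef ↔ (D - Cᵀ * A⁻¹ * C).PosSemidef := by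
  have := hA.isUnit.invertible
  have := hD.isUnit.invertible
  simpa using (PosDef.fromBlocks₂₂ A C hD).symm.trans (PosDef.fromBlocks₁₁ C D hA)

/-- Weighting by a positive semidefinite matrix preserves the order of `det (1 + K * S)`. -/
theorem Matrix.PosSemidef.det_one_add_mul_le {n : Type*} [Fintype n] [DecidableEq n]
    {K L S : Matrix n n ℝ} (hK : K.PosSemidef) (hKL : (L - K).PosSemidef) (hS : S.PosSemidef) :
    0 < (1 + K * S).det ∧ (1 + K * S).det ≤ (1 + L * S).det := by
  obtain ⟨R, rfl⟩ := hS.exists_eq_mul_transpose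
  have hcomm (J : Matrix n n ℝ) : (1 + J * (R * Rᵀ)).det = (1 + Rᵀ * J * R).det := by
    rw [← Matrix.mul_assoc, det_one_add_mul_comm, ← Matrix.mul_assoc]
  have hP : (1 + Rᵀ * K * R).PosDef :=
    PosDef.one.add_posSemidef (by simpa using hK.conjTranspose_mul_mul_same R)
  rw [hcomm, hcomm]
  refine ⟨hP.det_pos, ?_⟩
  have h := hP.det_le_det_add (by simpa using hKL.conjTranspose_mul_mul_same R :
    (Rᵀ * (L - K) * R).PosSemidef)
  rwa [add_assoc, ← Matrix.add_mul, ← Matrix.mul_add, add_sub_cancel] at h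

/-- λ ↦ D(λ·G) is monotone nondecreasing on [0, ∞). -/
theorem infoGain_smul_mono (p q t : ℕ) (hp : 0 < p) (hq : 0 < q) (ht : 0 < t)
    (Qθx : Matrix (Fin p) (Fin p) ℝ) (hQθx : Qθx.PosDef)
    (M : Matrix (Fin q) (Fin p) ℝ)
    (Qφθ : Matrix (Fin q) (Fin q) ℝ) (hQφθ : Qφθ.PosSemidef)
    (Qv : Matrix (Fin t) (Fin t) ℝ) (hQv : Qv.PosDef)
    (G : Matrix (Fin t) (Fin q) ℝ)
    (l₁ l₂ : ℝ) (hl₁ : 0 ≤ l₁) (hl : l₁ ≤ l₂) :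
    infoGain Qθx M Qφθ Qv (l₁ • G) ≤ infoGain Qθx M Qφθ Qv (l₂ • G) := by
  obtain rfl | hlt := hl.eq_or_lt
  · exact le_rfl
  have hl₂ : 0 < l₂ := hl₁.trans_lt hlt
  have hA (l : ℝ) : ((l • G) * Qφθ * (l • G)ᵀ + Qv).PosDef :=
    PosDef.posSemidef_add (by simpa using hQφθ.mul_mul_conjTranspose_same (l • G)) hQv
  have hK (l : ℝ) (J : Matrix (Fin t) (Fin t) ℝ) :
      Mᵀ * (l • G)ᵀ * J * (l • G) * M = (G * M)ᵀ * (l ^ 2 • J) * (G * M) := by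
    simp only [transpose_smul, transpose_mul, Matrix.mul_smul, Matrix.smul_mul, smul_smul,
      Matrix.mul_assoc, sq]
  have hdiff : (l₂ ^ 2 • ((l₂ • G) * Qφθ * (l₂ • G)ᵀ + Qv)⁻¹ -
      l₁ ^ 2 • ((l₁ • G) * Qφθ * (l₁ • G)ᵀ + Qv)⁻¹).PosSemidef := by
    have h := ((hA l₁).posSemidef_schur_comm (hA l₂).inv ((l₁ / l₂) • 1)).mp ?_
    · have h' := h.smul (sq_nonneg l₂)
      convert h' using 1
      simp only [transpose_smul, transpose_one, Matrix.smul_mul, Matrix.mul_smul, Matrix.one_mul,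
        Matrix.mul_one, smul_sub, smul_smul]
      congr 2
      field_simp
    · have h : (0 : ℝ) ≤ 1 - (l₁ / l₂) ^ 2 := by
        rw [sub_nonneg]
        exact pow_le_one₀ (by positivity) ((div_le_one hl₂).mpr hl)
      convert hQv.posSemidef.smul h using 1
      rw [nonsing_inv_nonsing_inv _ (hA l₂).det_pos.ne'.isUnit]
      simp only [transpose_smul, transpose_one, Matrix.smul_mul, Matrix.mul_smul, Matrix.one_mul,
        Matrix.mul_one, smul_add, smul_smul, sub_smul, one_smul]
      have h_scale : l₁ / l₂ * (l₁ / l₂ * (l₂ * l₂)) = l₁ * l₁ := by field_simp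
      rw [h_scale, sq]
      abel
  have hpos : (l₁ ^ 2 • ((l₁ • G) * Qφθ * (l₁ • G)ᵀ + Qv)⁻¹).PosSemidef :=
    (hA l₁).inv.posSemidef.smul (sq_nonneg l₁)
  unfold infoGain
  rw [hK, hK]
  obtain ⟨h₀, hle⟩ := PosSemidef.det_one_add_mul_le
    (by simpa using hpos.conjTranspose_mul_mul_same (G * M))
    (L := (G * M)ᵀ * (l₂ ^ 2 • ((l₂ • G) * Qφθ * (l₂ • G)ᵀ + Qv)⁻¹) * (G * M))
    (K := (G * M)ᵀ * (l₁ ^ 2 • ((l₁ • G) * Qφθ * (l₁ • G)ᵀ + Qv)⁻¹) * (G * M))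
    (by
      rw [← Matrix.sub_mul, ← Matrix.mul_sub]
      exact hdiff.conjTranspose_mul_mul_same (G * M)) hQθx.posSemidef
  exact mul_le_mul_of_nonneg_left (Real.log_le_log h₀ hle) (by norm_num)
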